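/- Let V be a real Hilbert space, let m ∈ ℕ, and let χ : ℝ^m → V be a continuous linear map with Hilbert adjoint χ* : V → ℝ^m. On W := V × V × ℝ^m × ℝ^m define the continuous bilinear pairing b((f₁,f₂,f₃,f₄),(e₁,e₂,e₃,e₄)) = ⟪f₁,e₁⟫_V + ⟪f₂,e₂⟫_V + ⟨f₃,e₃⟩_{ℝ^m} + ⟨f₄,e₄⟩_{ℝ^m}, and define the continuous linear operator J : W → W by J(e₁,e₂,e₃,e₄) = (e₂, −e₁ + χ e₃, −χ* e₂ − e₄, e₃). Then J is skew with respect to b, i.e., b(J e, ê) = −b(J ê, e) for all e, ê ∈ W, and consequently D = { (J e, e) : e ∈ W } is a Dirac structure with respect to b: for all (f, e) ∈ W × W, (f, e) ∈ D if and only if b(f, ê) + b(f̂, e) = 0 for all (f̂, ê) ∈ D. -/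

import Mathlib

open scoped RealInnerProductSpace

/-- The continuous bilinear pairing on `W = V × V × ℝ^m × ℝ^m`:
`b((f₁,f₂,f₃,f₄),(e₁,e₂,e₃,e₄)) = ⟪f₁,e₁⟫ + ⟪f₂,e₂⟫ + ⟨f₃,e₃⟩ + ⟨f₄,e₄⟩`. -/
noncomputable def mqsPairing {V : Type*} [NormedAddCommGroup V] [InnerProductSpace ℝ V]
    {m : ℕ}
    (f e : V × V × EuclideanSpace ℝ (Fin m) × EuclideanSpace ℝ (Fin m)) : ℝ :=
  ⟪f.1, e.1⟫ + ⟪f.2.1, e.2.1⟫ + ⟪f.2.2.1, e.2.2.1⟫ + ⟪f.2.2.2, e.2.2.2⟫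

/-- The operator `J(e₁,e₂,e₃,e₄) = (e₂, −e₁ + χ e₃, −χ* e₂ − e₄, e₃)` on
`W = V × V × ℝ^m × ℝ^m`, where `χ* ` is the Hilbert adjoint of `χ`. -/
noncomputable def mqsJ {V : Type*} [NormedAddCommGroup V] [InnerProductSpace ℝ V]
    [CompleteSpace V] {m : ℕ} (χ : EuclideanSpace ℝ (Fin m) →L[ℝ] V)
    (e : V × V × EuclideanSpace ℝ (Fin m) × EuclideanSpace ℝ (Fin m)) :
    V × V × EuclideanSpace ℝ (Fin m) × EuclideanSpace ℝ (Fin m) :=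
  (e.2.1, -e.1 + χ e.2.2.1,
    -((ContinuousLinearMap.adjoint χ) e.2.1) - e.2.2.2, e.2.2.1)

/-- The pairing separates points in its first argument. -/
theorem mqsPairing_left_injective {V : Type*} [NormedAddCommGroup V] [InnerProductSpace ℝ V]
    {m : ℕ} {f g : V × V × EuclideanSpace ℝ (Fin m) × EuclideanSpace ℝ (Fin m)}
    (h : ∀ e, mqsPairing f e = mqsPairing g e) : f = g := by
  obtain ⟨f₁, f₂, f₃, f₄⟩ := f
  obtain ⟨g₁, g₂, g₃, g₄⟩ := g
  simp only [mqsPairing] at h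
  have h₁ : f₁ = g₁ := ext_inner_right ℝ fun v => by simpa using h (v, 0, 0, 0)
  have h₂ : f₂ = g₂ := ext_inner_right ℝ fun v => by simpa using h (0, v, 0, 0)
  have h₃ : f₃ = g₃ := ext_inner_right ℝ fun v => by
    simpa only [inner_zero_right, zero_add, add_zero] using h (0, 0, v, 0)
  have h₄ : f₄ = g₄ := ext_inner_right ℝ fun v => by
    simpa only [inner_zero_right, zero_add, add_zero] using h (0, 0, 0, v)
  rw [h₁, h₂, h₃, h₄]

/-- The operator `mqsJ χ` is skew with respect to the pairing. -/
theorem mqsPairing_mqsJ_skew {V : Type*} [NormedAddCommGroup V] [InnerProductSpace ℝ V]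
    [CompleteSpace V] {m : ℕ} (χ : EuclideanSpace ℝ (Fin m) →L[ℝ] V)
    (e g : V × V × EuclideanSpace ℝ (Fin m) × EuclideanSpace ℝ (Fin m)) :
    mqsPairing (mqsJ χ e) g = - mqsPairing (mqsJ χ g) e := by
  simp only [mqsPairing, mqsJ, inner_add_left, inner_sub_left, inner_neg_left,
    ContinuousLinearMap.adjoint_inner_left]
  rw [real_inner_comm g.1 e.2.1, real_inner_comm g.2.1 e.1,
    real_inner_comm g.2.1 (χ e.2.2.1), real_inner_comm (χ g.2.2.1) e.2.1,
    real_inner_comm g.2.2.1 e.2.2.2, real_inner_comm g.2.2.2 e.2.2.1]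
  ring

/-- For a real Hilbert space `V` and a continuous linear map
`χ : ℝ^m → V`, the operator `J` above is skew with respect to the pairing `b`, and
consequently `D = {(J e, e) : e ∈ W}` is a Dirac structure with respect to `b`. -/
theorem mqs_dirac_structure {V : Type*} [NormedAddCommGroup V] [InnerProductSpace ℝ V]
    [CompleteSpace V] {m : ℕ} (χ : EuclideanSpace ℝ (Fin m) →L[ℝ] V) :
    (∀ e g : V × V × EuclideanSpace ℝ (Fin m) × EuclideanSpace ℝ (Fin m),
      mqsPairing (mqsJ χ e) g = - mqsPairing (mqsJ χ g) e) ∧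
    (∀ f e : V × V × EuclideanSpace ℝ (Fin m) × EuclideanSpace ℝ (Fin m),
      (f, e) ∈ {p | ∃ e', p = (mqsJ χ e', e')} ↔
        ∀ q ∈ {p : (V × V × EuclideanSpace ℝ (Fin m) × EuclideanSpace ℝ (Fin m)) ×
            (V × V × EuclideanSpace ℝ (Fin m) × EuclideanSpace ℝ (Fin m)) |
            ∃ e', p = (mqsJ χ e', e')},
          mqsPairing f q.2 + mqsPairing q.1 e = 0) := by
  refine ⟨mqsPairing_mqsJ_skew χ, fun f e => ⟨?_, fun h => ⟨e, ?_⟩⟩⟩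
  · rintro ⟨e', he⟩ q ⟨g, rfl⟩
    obtain ⟨rfl, rfl⟩ := Prod.mk.inj he
    rw [mqsPairing_mqsJ_skew, neg_add_cancel]
  · refine Prod.ext (mqsPairing_left_injective fun g => ?_) rfl
    rw [mqsPairing_mqsJ_skew χ e g]
    exact eq_neg_of_add_eq_zero_left (h _ ⟨g, rfl⟩)
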